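/- Let λ₁, λ₂, λ₃ be real numbers and let Φ be the unital qubit map on 2×2 complex matrices determined by Φ(I) = I, Φ(σ_x) = λ₁σ_x, Φ(σ_y) = λ₂σ_y, Φ(σ_z) = λ₃σ_z (where σ_x, σ_y, σ_z are the Pauli matrices), and assume Φ is CPTP. Then (id₂ ⊗ Φ)(ρ) is classical-quantum with respect to the first subsystem for every state ρ on ℂ² ⊗ ℂ² if and only if λ₁ = λ₂ = λ₃ = 0. (Unital qubit discord-breaking channels acting on subsystem B, Fig. 2.) -/

import Mathlib

open Matrix
open scoped Kronecker ComplexOrder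

noncomputable section

/-- A state: positive semidefinite matrix with unit trace. -/
def IsState {ι : Type} [Fintype ι] (ρ : Matrix ι ι ℂ) : Prop :=
  ρ.PosSemidef ∧ ρ.trace = 1

/-- The rank-one matrix `|ψ⟩⟨ψ| = ψ ψ†`. -/
def outer {d : ℕ} (ψ : Fin d → ℂ) : Matrix (Fin d) (Fin d) ℂ :=
  Matrix.of fun i j => ψ i * star (ψ j)

/-- A bipartite state (on `ℂ^{dA} ⊗ ℂ^{dB}`, Kronecker-product convention) is
classical-quantum with respect to subsystem `A` if it is a convex combination
`∑ k, p k • |ψ k⟩⟨ψ k| ⊗ σB k` with `{ψ k}` orthonormal in `ℂ^{dA}` and `σB k` states. -/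
def IsCQ {dA dB : ℕ} (ρ : Matrix (Fin dA × Fin dB) (Fin dA × Fin dB) ℂ) : Prop :=
  ∃ (n : ℕ) (ψ : Fin n → Fin dA → ℂ) (p : Fin n → ℝ)
    (σB : Fin n → Matrix (Fin dB) (Fin dB) ℂ),
      (∀ k l, star (ψ k) ⬝ᵥ ψ l = if k = l then 1 else 0) ∧
      (∀ k, 0 ≤ p k) ∧ (∑ k, p k = 1) ∧ (∀ k, IsState (σB k)) ∧
      ρ = ∑ k, (p k : ℂ) • (outer (ψ k) ⊗ₖ σB k)

/-- The `(a,b)` block (a matrix on the second factor) of a matrix on `Fin m × ι`. -/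
def blockA {m : ℕ} {ι : Type} (a b : Fin m) :
    Matrix (Fin m × ι) (Fin m × ι) ℂ →ₗ[ℂ] Matrix ι ι ℂ where
  toFun M := Matrix.of fun i j => M (a, i) (b, j)
  map_add' _ _ := rfl
  map_smul' _ _ := rfl

/-- The `(i,j)` slice (a matrix on the first factor) of a matrix on `Fin m × Fin d`. -/
def blockB {m d : ℕ} (i j : Fin d) :
    Matrix (Fin m × Fin d) (Fin m × Fin d) ℂ →ₗ[ℂ] Matrix (Fin m) (Fin m) ℂ where
  toFun M := Matrix.of fun a b => M (a, i) (b, j)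
  map_add' _ _ := rfl
  map_smul' _ _ := rfl

/-- `id_m ⊗ Φ`: the extension of `Φ` (acting on the second factor) by the identity
on the first factor.  On Kronecker products, `(id_m ⊗ Φ)(Y ⊗ₖ X) = Y ⊗ₖ Φ X`. -/
def idTensor {ι : Type} (m : ℕ) (Φ : Matrix ι ι ℂ →ₗ[ℂ] Matrix ι ι ℂ) :
    Matrix (Fin m × ι) (Fin m × ι) ℂ →ₗ[ℂ] Matrix (Fin m × ι) (Fin m × ι) ℂ where
  toFun M := Matrix.of fun p q => Φ (blockA p.1 q.1 M) p.2 q.2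
  map_add' M N := by
    ext ⟨a, i⟩ ⟨b, j⟩
    simp [Matrix.add_apply]
  map_smul' c M := by
    ext ⟨a, i⟩ ⟨b, j⟩
    simp [Matrix.smul_apply]

/-- `Φ ⊗ id_m`: the extension of `Φ` (acting on the first factor) by the identity
on the second factor.  On Kronecker products, `(Φ ⊗ id_m)(X ⊗ₖ Y) = Φ X ⊗ₖ Y`. -/
def tensorId {d : ℕ} (Φ : Matrix (Fin d) (Fin d) ℂ →ₗ[ℂ] Matrix (Fin d) (Fin d) ℂ)
    (m : ℕ) :
    Matrix (Fin d × Fin m) (Fin d × Fin m) ℂ →ₗ[ℂ]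
      Matrix (Fin d × Fin m) (Fin d × Fin m) ℂ where
  toFun M := Matrix.of fun p q => Φ (blockB p.2 q.2 M) p.1 q.1
  map_add' M N := by
    ext ⟨a, i⟩ ⟨b, j⟩
    simp [Matrix.add_apply]
  map_smul' c M := by
    ext ⟨a, i⟩ ⟨b, j⟩
    simp [Matrix.smul_apply]

/-- CPTP: trace preserving and completely positive (every extension `id_k ⊗ Φ`
maps positive semidefinite matrices to positive semidefinite matrices). -/
def IsCPTP {ι : Type} [Fintype ι] (Φ : Matrix ι ι ℂ →ₗ[ℂ] Matrix ι ι ℂ) : Prop :=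
  (∀ X, (Φ X).trace = X.trace) ∧
  ∀ k : ℕ, ∀ M : Matrix (Fin k × ι) (Fin k × ι) ℂ,
    M.PosSemidef → (idTensor k Φ M).PosSemidef

/-- Partial trace over the second (B) factor: `tr_B(X ⊗ₖ Y) = tr(Y) • X`. -/
def ptraceB {dA dB : ℕ} (M : Matrix (Fin dA × Fin dB) (Fin dA × Fin dB) ℂ) :
    Matrix (Fin dA) (Fin dA) ℂ :=
  Matrix.of fun a b => ∑ i, M (a, i) (b, i)

/-- The point channel with fixed state `σ`: `X ↦ tr(X) • σ`. -/
def pointChannel {d : ℕ} (σ : Matrix (Fin d) (Fin d) ℂ) :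
    Matrix (Fin d) (Fin d) ℂ →ₗ[ℂ] Matrix (Fin d) (Fin d) ℂ where
  toFun X := X.trace • σ
  map_add' X Y := by simp [Matrix.trace_add, add_smul]
  map_smul' c X := by simp [Matrix.trace_smul, smul_smul]

/-- A quantum-classical channel: `Φ(X) = ∑ k, tr(F k * X) • |ψ k⟩⟨ψ k|` for an
orthonormal family `{ψ k}` and a POVM `{F k}`. -/
def IsQCChannel {d : ℕ} (Φ : Matrix (Fin d) (Fin d) ℂ →ₗ[ℂ] Matrix (Fin d) (Fin d) ℂ) :
    Prop :=
  ∃ (n : ℕ) (ψ : Fin n → Fin d → ℂ) (F : Fin n → Matrix (Fin d) (Fin d) ℂ),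
    (∀ k l, star (ψ k) ⬝ᵥ ψ l = if k = l then 1 else 0) ∧
    (∀ k, (F k).PosSemidef) ∧ (∑ k, F k = 1) ∧
    (∀ X, Φ X = ∑ k, (F k * X).trace • outer (ψ k))

/-- The Pauli matrix `σ_x`. -/
def pauliX : Matrix (Fin 2) (Fin 2) ℂ := !![0, 1; 1, 0]

/-- The Pauli matrix `σ_y`. -/
def pauliY : Matrix (Fin 2) (Fin 2) ℂ := !![0, -Complex.I; Complex.I, 0]

/-- The Pauli matrix `σ_z`. -/
def pauliZ : Matrix (Fin 2) (Fin 2) ℂ := !![1, 0; 0, -1]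

theorem blockA_apply {m : ℕ} {ι : Type} (a b : Fin m) (M : Matrix (Fin m × ι) (Fin m × ι) ℂ)
    (i j : ι) : blockA a b M i j = M (a, i) (b, j) := rfl

theorem blockB_apply {m d : ℕ} (i j : Fin d) (M : Matrix (Fin m × Fin d) (Fin m × Fin d) ℂ)
    (a b : Fin m) : blockB i j M a b = M (a, i) (b, j) := rfl

/-- The extended channel acts on Kronecker products factorwise. -/
theorem idTensor_kronecker {ι : Type} (m : ℕ) (Φ : Matrix ι ι ℂ →ₗ[ℂ] Matrix ι ι ℂ)
    (Y : Matrix (Fin m) (Fin m) ℂ) (X : Matrix ι ι ℂ) :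
    idTensor m Φ (Y ⊗ₖ X) = Y ⊗ₖ Φ X := by
  ext ⟨a, i⟩ ⟨b, j⟩
  have h : blockA a b (Y ⊗ₖ X) = Y a b • X := by
    ext i j
    simp [blockA_apply]
  simp [idTensor, h]

/-- A slice of a Kronecker product is a multiple of the first factor. -/
theorem blockB_kronecker {m d : ℕ} (i j : Fin d) (Y : Matrix (Fin m) (Fin m) ℂ)
    (X : Matrix (Fin d) (Fin d) ℂ) : blockB i j (Y ⊗ₖ X) = X i j • Y := by
  ext a b
  simp [blockB_apply, mul_comm]

theorem outer_mul_outer {d : ℕ} (ψ φ : Fin d → ℂ) :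
    outer ψ * outer φ = (star ψ ⬝ᵥ φ) • vecMulVec ψ (star φ) := by
  ext i j
  simp only [outer, mul_apply, of_apply, Matrix.smul_apply, smul_eq_mul, dotProduct, Finset.sum_mul,
    Pi.star_apply, vecMulVec_apply]
  exact Finset.sum_congr rfl fun k _ => by ring

/-- The slices of a classical-quantum state commute pairwise. -/
theorem IsCQ.commute_blockB {dA dB : ℕ}
    {ρ : Matrix (Fin dA × Fin dB) (Fin dA × Fin dB) ℂ} (h : IsCQ ρ) (i j k l : Fin dB) :
    Commute (blockB i j ρ) (blockB k l ρ) := by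
  obtain ⟨n, ψ, p, σ, hψ, -, -, -, rfl⟩ := h
  have hcomm (s t : Fin n) : Commute (outer (ψ s)) (outer (ψ t)) := by
    rcases eq_or_ne s t with rfl | hst
    · exact Commute.refl _
    · simp [Commute, SemiconjBy, outer_mul_outer, hψ, hst, hst.symm]
  simp only [map_sum, map_smul, blockB_kronecker]
  refine Commute.sum_left _ _ _ fun s _ => Commute.sum_right _ _ _ fun t _ => ?_
  exact ((((hcomm s t).smul_left _).smul_left _).smul_right _).smul_right _

/-- The spectral decomposition of a Hermitian matrix into rank-one projections. -/
theorem eq_sum_eigenvalues_smul_outer {d : ℕ} {R : Matrix (Fin d) (Fin d) ℂ}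
    (hR : R.IsHermitian) :
    R = ∑ k, (hR.eigenvalues k : ℂ) • outer (hR.eigenvectorBasis k) := by
  conv_lhs => rw [hR.spectral_theorem, Unitary.conjStarAlgAut_apply]
  ext a b
  rw [mul_apply]
  simp only [mul_diagonal, Matrix.sum_apply, Matrix.smul_apply, outer, of_apply, smul_eq_mul,
    star_apply, IsHermitian.eigenvectorUnitary_apply, Function.comp_apply]
  exact Finset.sum_congr rfl fun k _ => by simp; ring

/-- Product states are classical-quantum. -/
theorem isCQ_kronecker {dA dB : ℕ} {R : Matrix (Fin dA) (Fin dA) ℂ}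
    {σ : Matrix (Fin dB) (Fin dB) ℂ} (hR : IsState R) (hσ : IsState σ) : IsCQ (R ⊗ₖ σ) := by
  have hH := hR.1.isHermitian
  refine ⟨dA, fun k => hH.eigenvectorBasis k, hH.eigenvalues, fun _ => σ, fun k l => ?_,
    hR.1.eigenvalues_nonneg, ?_, fun _ => hσ, ?_⟩
  · rw [dotProduct_comm, ← EuclideanSpace.inner_eq_star_dotProduct]
    exact orthonormal_iff_ite.mp hH.eigenvectorBasis.orthonormal k l
  · have h := hH.trace_eq_sum_eigenvalues
    rw [hR.2] at h
    exact Complex.ofReal_injective (by simpa using h.symm)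
  · conv_lhs => rw [eq_sum_eigenvalues_smul_outer hH]
    ext ⟨a, i⟩ ⟨b, j⟩
    simp [Matrix.sum_apply, Finset.sum_mul, mul_assoc]

/-- The partial trace of a state is a state. -/
theorem IsState.ptraceB {dA dB : ℕ} {ρ : Matrix (Fin dA × Fin dB) (Fin dA × Fin dB) ℂ}
    (h : IsState ρ) : IsState (ptraceB ρ) := by
  constructor
  · have hsum : _root_.ptraceB ρ = ∑ i, ρ.submatrix (fun a => (a, i)) (fun a => (a, i)) := by
      ext a b
      simp [_root_.ptraceB, Matrix.sum_apply]
    rw [hsum]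
    exact posSemidef_sum _ fun i _ => h.1.submatrix _
  · rw [← h.2]
    simp [_root_.ptraceB, trace, Fintype.sum_prod_type]

theorem idTensor_pointChannel {m d : ℕ} (σ : Matrix (Fin d) (Fin d) ℂ)
    (ρ : Matrix (Fin m × Fin d) (Fin m × Fin d) ℂ) :
    idTensor m (pointChannel σ) ρ = ptraceB ρ ⊗ₖ σ := by
  ext ⟨a, i⟩ ⟨b, j⟩
  simp [idTensor, pointChannel, ptraceB, blockA_apply, trace]

/-- The maximally mixed qubit state. -/
theorem isState_half_one : IsState ((1 / 2 : ℂ) • (1 : Matrix (Fin 2) (Fin 2) ℂ)) := by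
  refine ⟨PosSemidef.one.smul (by positivity), ?_⟩
  simp

/-- Expansion of a qubit matrix in the Pauli basis. -/
theorem eq_pauli_expansion (X : Matrix (Fin 2) (Fin 2) ℂ) :
    X = ((X 0 0 + X 1 1) / 2) • (1 : Matrix (Fin 2) (Fin 2) ℂ) +
      ((X 0 1 + X 1 0) / 2) • pauliX + (Complex.I * (X 0 1 - X 1 0) / 2) • pauliY +
      ((X 0 0 - X 1 1) / 2) • pauliZ := by
  ext i j
  fin_cases i <;> fin_cases j <;> simp [pauliX, pauliY, pauliZ] <;> ring_nf <;>
    simp [Complex.I_sq] <;> ring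

/-- The projection onto the first basis vector. -/
def projZero : Matrix (Fin 2) (Fin 2) ℂ := !![1, 0; 0, 0]

/-- The projection onto the vector `(1, 1) / √2`. -/
def projPlus : Matrix (Fin 2) (Fin 2) ℂ := !![1 / 2, 1 / 2; 1 / 2, 1 / 2]

theorem posSemidef_of_isHermitian_of_sq {d : ℕ} {Q : Matrix (Fin d) (Fin d) ℂ} {c : ℂ}
    (hc : 0 ≤ c) (hQ : Q.IsHermitian) (h : Q = c • (Q * Q)) : Q.PosSemidef := by
  have := (posSemidef_conjTranspose_mul_self Q).smul hc
  rwa [hQ.eq, ← h] at this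

theorem posSemidef_projZero : projZero.PosSemidef := by
  refine posSemidef_of_isHermitian_of_sq zero_le_one ?_ ?_
  · ext i j
    fin_cases i <;> fin_cases j <;> simp [projZero]
  · ext i j
    fin_cases i <;> fin_cases j <;> simp [projZero]

theorem posSemidef_projPlus : projPlus.PosSemidef := by
  refine posSemidef_of_isHermitian_of_sq zero_le_one ?_ ?_
  · ext i j
    fin_cases i <;> fin_cases j <;> simp [projPlus]
  · ext i j
    fin_cases i <;> fin_cases j <;> simp [projPlus] <;> norm_num

/-- Commuting combinations of the two noncommuting projections are proportional. -/
theorem mul_eq_mul_of_commute_proj {x y z w : ℂ}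
    (h : Commute (x • projZero + y • projPlus) (z • projZero + w • projPlus)) :
    x * w = y * z := by
  have h01 := congrFun (congrFun h.eq 0) 1
  simp [projZero, projPlus, mul_apply, Fin.sum_univ_two] at h01
  linear_combination 2 * h01

/-- A mixture of product states that correlates the two noncommuting projections on the first
factor with the eigenspaces of an involution `P` on the second factor. -/
def probeState (P : Matrix (Fin 2) (Fin 2) ℂ) : Matrix (Fin 2 × Fin 2) (Fin 2 × Fin 2) ℂ :=
  (1 / 4 : ℂ) • (projZero ⊗ₖ (1 + P) + projPlus ⊗ₖ (1 - P))

theorem isState_probeState {P : Matrix (Fin 2) (Fin 2) ℂ} (hP : P.IsHermitian)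
    (hsq : P * P = 1) (htr : P.trace = 0) : IsState (probeState P) := by
  have hadd : (1 + P).PosSemidef := by
    refine posSemidef_of_isHermitian_of_sq (c := 1 / 2) (by positivity) (isHermitian_one.add hP) ?_
    simp only [add_mul, mul_add, hsq, one_mul, mul_one]
    module
  have hsub : (1 - P).PosSemidef := by
    refine posSemidef_of_isHermitian_of_sq (c := 1 / 2) (by positivity) (isHermitian_one.sub hP) ?_
    simp only [sub_mul, mul_sub, hsq, one_mul, mul_one]
    module
  refine ⟨((posSemidef_projZero.kronecker hadd).add
    (posSemidef_projPlus.kronecker hsub)).smul (by positivity), ?_⟩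
  simp only [probeState, trace_smul, trace_add, trace_sub, trace_kronecker, htr, trace_one]
  simp [projZero, projPlus, trace_fin_two]
  norm_num

/-- Comparing two slices of the image of `probeState P` under a channel that scales `P`. -/
theorem slice_relation {Φ : Matrix (Fin 2) (Fin 2) ℂ →ₗ[ℂ] Matrix (Fin 2) (Fin 2) ℂ}
    {P : Matrix (Fin 2) (Fin 2) ℂ} {c : ℂ} (hI : Φ 1 = 1) (hP : Φ P = c • P)
    (h : IsCQ (idTensor 2 Φ (probeState P))) (i j k l : Fin 2) :
    (1 + c • P) i j * (1 - c • P) k l = (1 - c • P) i j * (1 + c • P) k l := by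
  have hcomm := h.commute_blockB i j k l
  simp only [probeState, map_smul, map_add, idTensor_kronecker, map_sub, hI, hP,
    blockB_kronecker, smul_add, smul_smul] at hcomm
  linear_combination 16 * mul_eq_mul_of_commute_proj hcomm

/-- Fig. 2, channel on subsystem B: a unital qubit channel with
Pauli damping parameters `(λ₁, λ₂, λ₃)` acting on subsystem `B` is
discord-breaking iff `λ₁ = λ₂ = λ₃ = 0`. -/
theorem stmt_15 (l₁ l₂ l₃ : ℝ)
    (Φ : Matrix (Fin 2) (Fin 2) ℂ →ₗ[ℂ] Matrix (Fin 2) (Fin 2) ℂ)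
    (hI : Φ 1 = 1)
    (hx : Φ pauliX = (l₁ : ℂ) • pauliX)
    (hy : Φ pauliY = (l₂ : ℂ) • pauliY)
    (hz : Φ pauliZ = (l₃ : ℂ) • pauliZ)
    (hΦ : IsCPTP Φ) :
    (∀ ρ : Matrix (Fin 2 × Fin 2) (Fin 2 × Fin 2) ℂ, IsState ρ →
      IsCQ (idTensor 2 Φ ρ)) ↔ (l₁ = 0 ∧ l₂ = 0 ∧ l₃ = 0) := by
  constructor
  · intro h
    refine ⟨?_, ?_, ?_⟩
    · have hs : IsState (probeState pauliX) := by
        refine isState_probeState ?_ ?_ ?_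
        · ext i j
          fin_cases i <;> fin_cases j <;> simp [pauliX]
        · ext i j
          fin_cases i <;> fin_cases j <;> simp [pauliX]
        · simp [pauliX, trace_fin_two]
      have hr := slice_relation hI hx (h _ hs) 0 0 0 1
      simp [pauliX] at hr
      exact_mod_cast (show (l₁ : ℂ) = 0 by linear_combination (-1 / 2 : ℂ) * hr)
    · have hs : IsState (probeState pauliY) := by
        refine isState_probeState ?_ ?_ ?_
        · ext i j
          fin_cases i <;> fin_cases j <;> simp [pauliY]
        · ext i j
          fin_cases i <;> fin_cases j <;> simp [pauliY]
        · simp [pauliY, trace_fin_two]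
      have hr := slice_relation hI hy (h _ hs) 0 0 0 1
      simp [pauliY] at hr
      exact_mod_cast (show (l₂ : ℂ) = 0 by
        linear_combination (-Complex.I / 2 : ℂ) * hr + (l₂ : ℂ) * Complex.I_sq)
    · have hs : IsState (probeState pauliZ) := by
        refine isState_probeState ?_ ?_ ?_
        · ext i j
          fin_cases i <;> fin_cases j <;> simp [pauliZ]
        · ext i j
          fin_cases i <;> fin_cases j <;> simp [pauliZ]
        · simp [pauliZ, trace_fin_two]
      have hr := slice_relation hI hz (h _ hs) 0 0 1 1
      simp [pauliZ] at hr
      exact_mod_cast (show (l₃ : ℂ) = 0 by linear_combination (1 / 4 : ℂ) * hr)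
  · rintro ⟨rfl, rfl, rfl⟩ ρ hρ
    have hpoint : Φ = pointChannel ((1 / 2 : ℂ) • 1) := by
      refine LinearMap.ext fun X => ?_
      conv_lhs => rw [eq_pauli_expansion X]
      simp only [map_add, map_smul, hI, hx, hy, hz]
      simp [pointChannel, trace_fin_two, smul_smul, div_eq_mul_inv]
    rw [hpoint, idTensor_pointChannel]
    exact isCQ_kronecker hρ.ptraceB isState_half_one
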